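/- Let n ≥ 1 and d ≥ 1 be natural numbers. For every k ∈ ℕ and all complex k×k matrices X_1, …, X_n, one has H_{2d}(X_1, …, X_n) = Σ over pairs of words u, v : Fin d → Fin n of G_{n,d}(u, v) · X_{ū} X_v, where ū denotes the reversal of the word u (ū(i) = u(d−1−i)). -/

import Mathlib

open Matrix BigOperators

/-- Product of ring elements along a word `w : Fin d → Fin n`:
`X_{w 0} * X_{w 1} * ⋯ * X_{w (d-1)}`. -/
noncomputable def wordProd {R : Type*} [Monoid R] {n d : ℕ} (X : Fin n → R)
    (w : Fin d → Fin n) : R :=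
  (List.ofFn fun i => X (w i)).prod

/-- Number of occurrences of the letter `j` in the word `w`. -/
def letterCount {n d : ℕ} (w : Fin d → Fin n) (j : Fin n) : ℕ :=
  (Finset.univ.filter fun i => w i = j).card

/-- Coefficient of the word `w` in the NCHS polynomial of degree `d`:
`(∏_j k_j(w)!) / d!`. -/
noncomputable def nchsCoeff {n : ℕ} (d : ℕ) (w : Fin d → Fin n) : ℝ :=
  ((∏ j : Fin n, (letterCount w j).factorial : ℕ) : ℝ) / (d.factorial : ℝ)

/-- The noncommutative complete homogeneous symmetric polynomial of degree `d`
evaluated at `X`. -/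
noncomputable def nchs {R : Type*} [Ring R] [Module ℝ R] {n : ℕ} (d : ℕ)
    (X : Fin n → R) : R :=
  ∑ w : Fin d → Fin n, nchsCoeff d w • wordProd X w

/-- The matrix `G_{n,d}`, indexed by words of degree `d` in `n` letters, with
`(u, v)` entry `(∏ j, (k_j(u) + k_j(v))!)/(2d)!`. -/
noncomputable def Gmat (n d : ℕ) : Matrix (Fin d → Fin n) (Fin d → Fin n) ℝ :=
  fun u v =>
    ((∏ j : Fin n, (letterCount u j + letterCount v j).factorial : ℕ) : ℝ) /
      ((2 * d).factorial : ℝ)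

theorem wordProd_append {R : Type*} [Monoid R] {n a b : ℕ} (X : Fin n → R)
    (u : Fin a → Fin n) (v : Fin b → Fin n) :
    wordProd X (Fin.append u v) = wordProd X u * wordProd X v := by
  unfold wordProd
  rw [← List.prod_append, ← List.ofFn_fin_append]
  congr 2
  ext i
  refine Fin.addCases (fun i => ?_) (fun i => ?_) i <;> simp

theorem letterCount_append {n a b : ℕ} (u : Fin a → Fin n) (v : Fin b → Fin n) (j : Fin n) :
    letterCount (Fin.append u v) j = letterCount u j + letterCount v j := by
  simp only [letterCount, Finset.card_filter, Fin.sum_univ_add, Fin.append_left,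
    Fin.append_right]

theorem letterCount_rev {n d : ℕ} (u : Fin d → Fin n) (j : Fin n) :
    letterCount (fun i => u i.rev) j = letterCount u j := by
  simp only [letterCount, Finset.card_filter]
  exact Equiv.sum_comp Fin.revPerm fun i => if u i = j then 1 else 0

theorem nchsCoeff_append_rev {n d : ℕ} (u v : Fin d → Fin n) :
    nchsCoeff (d + d) (Fin.append (fun i => u i.rev) v) = Gmat n d u v := by
  simp only [nchsCoeff, Gmat, letterCount_append, letterCount_rev, two_mul]

/-- Gram representation: `H_{2d}(X) = ∑_{u,v} G_{n,d}(u,v) · X_{ū} X_v`, where `ū`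
is the reversal of the word `u`. -/
theorem stmt_9 (n d : ℕ) (hn : 1 ≤ n) (hd : 1 ≤ d) (k : ℕ)
    (X : Fin n → Matrix (Fin k) (Fin k) ℂ) :
    nchs (2 * d) X =
      ∑ u : Fin d → Fin n, ∑ v : Fin d → Fin n,
        Gmat n d u v • (wordProd X (fun i => u i.rev) * wordProd X v) := by
  rw [two_mul, nchs, ← (Fin.appendEquiv d d).sum_comp, Fintype.sum_prod_type,
    ← (Equiv.arrowCongr Fin.revPerm (Equiv.refl (Fin n))).sum_comp]
  refine Finset.sum_congr rfl fun u _ => Finset.sum_congr rfl fun v _ => ?_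
  rw [← nchsCoeff_append_rev, ← wordProd_append]
  rfl
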